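/- For every L ≥ 0 and every (s_0,x_0) ∈ [0,T)×Ω, the set X^L(s_0,x_0) is a compact subset of Ω with respect to the supremum norm ‖·‖_∞. -/

import Mathlib

open MeasureTheory Set Filter Topology
open scoped InnerProductSpace

noncomputable section

namespace PHJ

/-- The Euclidean state space `ℝ^d`. -/
abbrev E (d : ℕ) := EuclideanSpace ℝ (Fin d)

/-- A path; only its values on `[0, T]` are relevant. -/
abbrev Path (d : ℕ) := ℝ → E d

/-- The set `Ω = D([0,T], ℝ^d)` of paths that are right-continuous on `[0,T)` and have
left limits on `(0,T]`. -/
def Cadlag (T : ℝ) (d : ℕ) : Set (Path d) :=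
  {x | (∀ t ∈ Ico (0 : ℝ) T, ContinuousWithinAt x (Ici t) t) ∧
       (∀ t ∈ Ioc (0 : ℝ) T, ∃ l : E d, Tendsto x (nhdsWithin t (Iio t)) (nhds l))}

/-- The running supremum `sup_{0 ≤ s ≤ t} |x(s)|`. -/
def runSup (d : ℕ) (x : Path d) (t : ℝ) : ℝ :=
  sSup ((fun s => ‖x s‖) '' Icc 0 t)

/-- The supremum distance `sup_{0 ≤ s ≤ T} |x(s) − y(s)|`. -/
def supDist (T : ℝ) (d : ℕ) (x y : Path d) : ℝ :=
  sSup ((fun s => ‖x s - y s‖) '' Icc 0 T)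

/-- The stopped supremum distance `sup_{0 ≤ r ≤ T} |x(r ∧ t) − y(r ∧ s)|`. -/
def stopDist (T : ℝ) (d : ℕ) (t : ℝ) (x : Path d) (s : ℝ) (y : Path d) : ℝ :=
  sSup ((fun r => ‖x (min r t) - y (min r s)‖) '' Icc 0 T)

/-- The pseudometric `d_∞` on `[0,T] × Ω`. -/
def dInf (T : ℝ) (d : ℕ) (p q : ℝ × Path d) : ℝ :=
  |p.1 - q.1| + stopDist T d p.1 p.2 q.1 q.2

/-- `g` is an integrable a.e.-derivative of `x` on `[s₀, T]` (so that `x` is absolutely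
continuous there) satisfying the growth bound `|x′(t)| ≤ L (1 + sup_{s ≤ t} |x(s)|)` a.e. -/
def XDeriv (T : ℝ) (d : ℕ) (L s₀ : ℝ) (x g : Path d) : Prop :=
  IntegrableOn g (Icc s₀ T) volume ∧
  (∀ t ∈ Icc s₀ T, x t = x s₀ + ∫ s in s₀..t, g s) ∧
  (∀ᵐ t ∂(volume.restrict (Ioo s₀ T)), ‖g t‖ ≤ L * (1 + runSup d x t))

/-- The set `X^L(s₀, x₀)` of "Lipschitz-like" paths. -/
def XSet (T : ℝ) (d : ℕ) (L s₀ : ℝ) (x₀ : Path d) : Set (Path d) :=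
  {x | x ∈ Cadlag T d ∧ (∀ t ∈ Icc 0 s₀, x t = x₀ t) ∧ ∃ g, XDeriv T d L s₀ x g}

/-- Type of Hamiltonians `H(t, x, y, z)`. -/
abbrev Ham (d : ℕ) := ℝ → Path d → ℝ → E d → ℝ

/-- The set `Y^L(s₀, x₀, y₀, z)` of characteristic pairs `(x, y)`. -/
def YSet (T : ℝ) (d : ℕ) (H : Ham d) (L s₀ : ℝ) (x₀ : Path d) (y₀ : ℝ) (z : E d) :
    Set (Path d × (ℝ → ℝ)) :=
  {p | p.1 ∈ Cadlag T d ∧ (∀ t ∈ Icc 0 s₀, p.1 t = x₀ t) ∧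
       ContinuousOn p.2 (Icc s₀ T) ∧
       ∃ g, XDeriv T d L s₀ p.1 g ∧
         IntegrableOn (fun s => ⟪g s, z⟫_ℝ - H s p.1 (p.2 s) z) (Icc s₀ T) volume ∧
         ∀ t ∈ Icc s₀ T, p.2 t = y₀ + ∫ s in s₀..t, (⟪g s, z⟫_ℝ - H s p.1 (p.2 s) z)}

/-- Assumption (i): for a.e. `t`, `(x, y, z) ↦ H(t, x, y, z)` is continuous. -/
def HamCont (T : ℝ) (d : ℕ) (H : Ham d) : Prop :=
  ∀ᵐ t ∂(volume.restrict (Ioo (0 : ℝ) T)),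
    ∀ x ∈ Cadlag T d, ∀ (y : ℝ) (z : E d), ∀ ε > (0 : ℝ), ∃ δ > (0 : ℝ),
      ∀ x' ∈ Cadlag T d, ∀ (y' : ℝ) (z' : E d),
        supDist T d x x' < δ → |y - y'| < δ → ‖z - z'‖ < δ →
        |H t x y z - H t x' y' z'| < ε

/-- Assumption (ii): `t ↦ H(t, x, y, z)` is Borel measurable. -/
def HamMeas (d : ℕ) (H : Ham d) : Prop :=
  ∀ (x : Path d) (y : ℝ) (z : E d), Measurable fun t => H t x y z

/-- Assumption (iii): Lipschitz continuity in `z` with constant `L_H (1 + sup_{s≤t} |x(s)|)`. -/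
def HamLipZ (T : ℝ) (d : ℕ) (H : Ham d) (LH : ℝ) : Prop :=
  0 ≤ LH ∧ ∀ᵐ t ∂(volume.restrict (Ioo (0 : ℝ) T)),
    ∀ x ∈ Cadlag T d, ∀ (y : ℝ) (z z' : E d),
      |H t x y z - H t x y z'| ≤ LH * (1 + runSup d x t) * ‖z - z'‖

/-- Assumption (iv): local Lipschitz continuity in `x` along `X^L`-paths,
with constant `M L`. -/
def HamLipX (T : ℝ) (d : ℕ) (H : Ham d) (M : ℝ → ℝ) : Prop :=
  ∀ L ≥ (0 : ℝ), 0 ≤ M L ∧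
    ∀ t₀ ∈ Ico (0 : ℝ) T, ∀ x₀ ∈ Cadlag T d,
      ∀ x ∈ XSet T d L t₀ x₀, ∀ x' ∈ XSet T d L t₀ x₀, ∀ (y : ℝ) (z : E d),
        ∀ᵐ t ∂(volume.restrict (Ioo t₀ T)),
          |H t x y z - H t x' y z| ≤
            M L * (1 + |y| + ‖z‖) * sSup ((fun s => ‖x s - x' s‖) '' Icc 0 t)

/-- Assumption (v): `y ↦ H(t, x, y, z)` is non-increasing. -/
def HamMono (T : ℝ) (d : ℕ) (H : Ham d) : Prop :=
  ∀ᵐ t ∂(volume.restrict (Ioo (0 : ℝ) T)),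
    ∀ x ∈ Cadlag T d, ∀ (z : E d) (y y' : ℝ), y ≤ y' → H t x y' z ≤ H t x y z

/-- Assumption (vi): growth bound `|H(t, x, y, 0)| ≤ C_H (1 + sup_{s≤t}|x(s)| + |y|)`. -/
def HamBound (T : ℝ) (d : ℕ) (H : Ham d) (CH : ℝ) : Prop :=
  0 ≤ CH ∧ ∀ᵐ t ∂(volume.restrict (Ioo (0 : ℝ) T)),
    ∀ x ∈ Cadlag T d, ∀ y : ℝ, |H t x y 0| ≤ CH * (1 + runSup d x t + |y|)

/-- Lower semicontinuity on `[0,T] × Ω` with respect to `d_∞`. -/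
def LscOn (T : ℝ) (d : ℕ) (u : ℝ → Path d → ℝ) : Prop :=
  ∀ t₀ ∈ Icc (0 : ℝ) T, ∀ x₀ ∈ Cadlag T d, ∀ c : ℝ, c < u t₀ x₀ →
    ∃ δ > (0 : ℝ), ∀ t ∈ Icc (0 : ℝ) T, ∀ x ∈ Cadlag T d,
      dInf T d (t₀, x₀) (t, x) < δ → c < u t x

/-- Upper semicontinuity on `[0,T] × Ω` with respect to `d_∞`. -/
def UscOn (T : ℝ) (d : ℕ) (u : ℝ → Path d → ℝ) : Prop :=
  ∀ t₀ ∈ Icc (0 : ℝ) T, ∀ x₀ ∈ Cadlag T d, ∀ c : ℝ, u t₀ x₀ < c →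
    ∃ δ > (0 : ℝ), ∀ t ∈ Icc (0 : ℝ) T, ∀ x ∈ Cadlag T d,
      dInf T d (t₀, x₀) (t, x) < δ → u t x < c

/-- Continuity of the terminal condition `h` with respect to the sup norm. -/
def TermCont (T : ℝ) (d : ℕ) (h : Path d → ℝ) : Prop :=
  ∀ x ∈ Cadlag T d, ∀ ε > (0 : ℝ), ∃ δ > (0 : ℝ), ∀ x' ∈ Cadlag T d,
    supDist T d x x' < δ → |h x' - h x| < ε

/-- `u` is a minimax `L`-supersolution of the terminal-value problem (TVP). -/
def MinimaxSuper (T : ℝ) (d : ℕ) (H : Ham d) (h : Path d → ℝ) (L : ℝ)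
    (u : ℝ → Path d → ℝ) : Prop :=
  LscOn T d u ∧ (∀ x ∈ Cadlag T d, h x ≤ u T x) ∧
  ∀ s₀ ∈ Ico (0 : ℝ) T, ∀ x₀ ∈ Cadlag T d, ∀ (z : E d) (y₀ : ℝ), u s₀ x₀ ≤ y₀ →
    ∃ p ∈ YSet T d H L s₀ x₀ y₀ z, ∀ t ∈ Icc s₀ T, u t p.1 ≤ p.2 t

/-- `u` is a minimax `L`-subsolution of the terminal-value problem (TVP). -/
def MinimaxSub (T : ℝ) (d : ℕ) (H : Ham d) (h : Path d → ℝ) (L : ℝ)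
    (u : ℝ → Path d → ℝ) : Prop :=
  UscOn T d u ∧ (∀ x ∈ Cadlag T d, u T x ≤ h x) ∧
  ∀ s₀ ∈ Ico (0 : ℝ) T, ∀ x₀ ∈ Cadlag T d, ∀ (z : E d) (y₀ : ℝ), y₀ ≤ u s₀ x₀ →
    ∃ p ∈ YSet T d H L s₀ x₀ y₀ z, ∀ t ∈ Icc s₀ T, p.2 t ≤ u t p.1

/-- `u` is a minimax `L`-solution of the terminal-value problem (TVP). -/
def MinimaxSol (T : ℝ) (d : ℕ) (H : Ham d) (h : Path d → ℝ) (L : ℝ)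
    (u : ℝ → Path d → ℝ) : Prop :=
  MinimaxSuper T d H h L u ∧ MinimaxSub T d H h L u

/-- Embedding of a path into the space of functions on `[0,T]` with the topology of
uniform convergence (i.e. the sup-norm topology). -/
def toUnif (T : ℝ) (d : ℕ) (x : Path d) : UniformFun (Icc (0 : ℝ) T) (E d) :=
  UniformFun.ofFun fun s => x s.1

/-- Embedding of a real-valued function into the space of functions on `[s₀,T]` with the
topology of uniform convergence. -/
def toUnifR (T s₀ : ℝ) (y : ℝ → ℝ) : UniformFun (Icc s₀ T) ℝ :=
  UniformFun.ofFun fun s => y s.1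


/-- Continuity on `[0,T] × Ω` with respect to `d_∞`. -/
def Cont2 (T : ℝ) (d : ℕ) (u : ℝ → Path d → ℝ) : Prop :=
  ∀ t₀ ∈ Icc (0 : ℝ) T, ∀ x₀ ∈ Cadlag T d, ∀ ε > (0 : ℝ), ∃ δ > (0 : ℝ),
    ∀ t ∈ Icc (0 : ℝ) T, ∀ x ∈ Cadlag T d,
      dInf T d (t₀, x₀) (t, x) < δ → |u t x - u t₀ x₀| < ε

open scoped BoundedContinuousFunction

theorem Cadlag.isBounded_image {T : ℝ} {d : ℕ} {x : Path d} (hx : x ∈ Cadlag T d) :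
    Bornology.IsBounded (x '' Icc 0 T) := by
  refine isCompact_Icc.induction_on (p := fun s => Bornology.IsBounded (x '' s)) (by simp)
    (fun s t hst ht => ht.subset (image_mono hst))
    (fun s t hs ht => by rw [image_union]; exact hs.union ht) fun t ht => ?_
  have right : ∃ U ∈ 𝓝[Icc 0 T ∩ Ici t] t, Bornology.IsBounded (x '' U) := by
    rcases ht.2.lt_or_eq with h | rfl
    · obtain ⟨U, hU, hb⟩ := Metric.exists_isBounded_image_of_tendsto (hx.1 t ⟨ht.1, h⟩)
      exact ⟨U, nhdsWithin_mono _ inter_subset_right hU, hb⟩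
    · refine ⟨{t}, ?_, by simp⟩
      have : Icc 0 t ∩ Ici t = {t} := by
        ext s; simp only [mem_inter_iff, mem_Icc, mem_Ici, mem_singleton_iff]
        constructor
        · rintro ⟨⟨-, h⟩, h'⟩; exact le_antisymm h h'
        · rintro rfl; exact ⟨ht, le_rfl⟩
      rw [this]; exact self_mem_nhdsWithin
  have left : ∃ U ∈ 𝓝[Icc 0 T ∩ Iio t] t, Bornology.IsBounded (x '' U) := by
    rcases ht.1.lt_or_eq with h | rfl
    · obtain ⟨l, hl⟩ := hx.2 t ⟨h, ht.2⟩
      obtain ⟨U, hU, hb⟩ := Metric.exists_isBounded_image_of_tendsto hl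
      exact ⟨U, nhdsWithin_mono _ inter_subset_right hU, hb⟩
    · refine ⟨∅, ?_, by simp⟩
      have : Icc 0 T ∩ Iio (0 : ℝ) = ∅ := by
        ext s; simp only [mem_inter_iff, mem_Icc, mem_Iio, mem_empty_iff_false, iff_false]
        rintro ⟨⟨h, -⟩, h'⟩; linarith
      rw [this]; simp
  obtain ⟨U, hU, hUb⟩ := left
  obtain ⟨V, hV, hVb⟩ := right
  refine ⟨U ∪ V, ?_, by rw [image_union]; exact hUb.union hVb⟩
  have : Icc 0 T = Icc 0 T ∩ Iio t ∪ Icc 0 T ∩ Ici t := by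
    rw [← inter_union_distrib_left, Iio_union_Ici, inter_univ]
  rw [this, nhdsWithin_union]
  exact ⟨mem_of_superset hU subset_union_left, mem_of_superset hV subset_union_right⟩

theorem Cadlag.bddAbove {T : ℝ} {d : ℕ} {x : Path d} (hx : x ∈ Cadlag T d) :
    BddAbove ((fun s => ‖x s‖) '' Icc 0 T) := by
  obtain ⟨C, hC⟩ := (Cadlag.isBounded_image hx).exists_norm_le
  exact ⟨C, by rintro _ ⟨s, hs, rfl⟩; exact hC _ ⟨s, hs, rfl⟩⟩

section RunSup

variable {T : ℝ} {d : ℕ} {x y : Path d}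

theorem norm_le_runSup (hb : BddAbove ((fun s => ‖x s‖) '' Icc 0 T)) {s t : ℝ}
    (hs : 0 ≤ s) (hst : s ≤ t) (ht : t ≤ T) : ‖x s‖ ≤ runSup d x t :=
  le_csSup (hb.mono (image_mono (Icc_subset_Icc_right ht))) ⟨s, ⟨hs, hst⟩, rfl⟩

theorem runSup_le {t C : ℝ} (ht : 0 ≤ t) (h : ∀ s ∈ Icc 0 t, ‖x s‖ ≤ C) : runSup d x t ≤ C :=
  csSup_le ((nonempty_Icc.2 ht).image _) (by rintro _ ⟨s, hs, rfl⟩; exact h s hs)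

theorem runSup_mono (hb : BddAbove ((fun s => ‖x s‖) '' Icc 0 T)) {s t : ℝ}
    (hs : 0 ≤ s) (hst : s ≤ t) (ht : t ≤ T) : runSup d x s ≤ runSup d x t :=
  runSup_le hs fun _ hr => norm_le_runSup hb hr.1 (hr.2.trans hst) ht

theorem runSup_nonneg (t : ℝ) : 0 ≤ runSup d x t :=
  Real.sSup_nonneg (by rintro _ ⟨s, -, rfl⟩; exact norm_nonneg _)

theorem runSup_congr {t : ℝ} (h : EqOn x y (Icc 0 t)) : runSup d x t = runSup d y t := by
  unfold runSup
  exact congrArg sSup (image_congr fun s hs => by rw [h hs])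

end RunSup

/-- The integrated form of the growth bound `|x′(t)| ≤ L (1 + sup_{s ≤ t} |x(s)|)`. -/
def IncrementBound (T : ℝ) (d : ℕ) (L s₀ : ℝ) (x : Path d) : Prop :=
  ∀ s t, s₀ ≤ s → s ≤ t → t ≤ T → ‖x t - x s‖ ≤ L * (t - s) * (1 + runSup d x t)

theorem XDeriv.incrementBound {T : ℝ} {d : ℕ} {L s₀ : ℝ} {x g : Path d} (hL : 0 ≤ L)
    (hs₀ : 0 ≤ s₀) (hb : BddAbove ((fun s => ‖x s‖) '' Icc 0 T)) (h : XDeriv T d L s₀ x g) :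
    IncrementBound T d L s₀ x := by
  obtain ⟨hi, hx, hg⟩ := h
  intro s t hs hst ht
  have hii : ∀ r ∈ Icc s₀ T, IntervalIntegrable g volume s₀ r := fun r hr =>
    (intervalIntegrable_iff_integrableOn_Icc_of_le hr.1).2
      (hi.mono_set (Icc_subset_Icc_right hr.2))
  have hsm : s ∈ Icc s₀ T := ⟨hs, hst.trans ht⟩
  have htm : t ∈ Icc s₀ T := ⟨hs.trans hst, ht⟩
  have e : x t - x s = ∫ r in s..t, g r := by
    rw [hx t htm, hx s hsm, add_sub_add_left_eq_sub,
      intervalIntegral.integral_interval_sub_left (hii t htm) (hii s hsm)]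
  rw [e]
  have hae : ∀ᵐ r, r ∈ uIoc s t → ‖g r‖ ≤ L * (1 + runSup d x t) := by
    rw [ae_restrict_iff' measurableSet_Ioo] at hg
    filter_upwards [hg, Measure.ae_ne volume T] with r hr hrT hrm
    rw [uIoc_of_le hst] at hrm
    refine (hr ⟨hs.trans_lt hrm.1, lt_of_le_of_ne (hrm.2.trans ht) hrT⟩).trans ?_
    gcongr
    exact runSup_mono hb (hs₀.trans (hs.trans hrm.1.le)) hrm.2 ht
  have := intervalIntegral.norm_integral_le_of_norm_le_const_ae hae
  rw [abs_of_nonneg (sub_nonneg.2 hst)] at this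
  linarith

/-- A discrete Grönwall estimate: over a step of length at most `1 / (2 L)`, the quantity
`1 + sup |x|` at most doubles. -/
theorem IncrementBound.one_add_runSup_le {T : ℝ} {d : ℕ} {L s₀ : ℝ} {x : Path d} (hL : 0 ≤ L)
    (hs₀ : 0 ≤ s₀) (hb : BddAbove ((fun s => ‖x s‖) '' Icc 0 T))
    (h : IncrementBound T d L s₀ x) {η : ℝ} (hη : 0 ≤ η) (hLη : L * η ≤ 1 / 2) (k : ℕ)
    (hk : s₀ + k * η ≤ T) :
    1 + runSup d x (s₀ + k * η) ≤ 2 ^ k * (1 + runSup d x s₀) := by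
  induction k with
  | zero => simp
  | succ k ih =>
    push_cast at hk ⊢
    have hle : s₀ + k * η ≤ s₀ + (k + 1) * η := by nlinarith
    have hk0 : s₀ ≤ s₀ + k * η := by
      have : (0 : ℝ) ≤ k * η := by positivity
      linarith
    specialize ih (hle.trans hk)
    set a := s₀ + k * η with ha
    set b := s₀ + (k + 1) * η with hbdef
    have hba : b - a = η := by rw [ha, hbdef]; ring
    have key : runSup d x b ≤ runSup d x a + 1 / 2 * (1 + runSup d x b) := by
      have hb0 := runSup_nonneg (x := x) b
      refine runSup_le (by linarith) fun r hr => ?_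
      rcases le_total r a with hra | har
      · have := norm_le_runSup hb hr.1 hra (hle.trans hk)
        linarith
      · have h1 := h a r hk0 har (hr.2.trans hk)
        have h2 : ‖x r‖ ≤ ‖x a‖ + ‖x r - x a‖ := by
          simpa using norm_add_le (x a) (x r - x a)
        have h3 := norm_le_runSup hb (hs₀.trans hk0) le_rfl (hle.trans hk)
        have h4 : L * (r - a) * (1 + runSup d x r) ≤ 1 / 2 * (1 + runSup d x b) := by
          have h5 := runSup_mono hb hr.1 hr.2 hk
          have h6 := runSup_nonneg (x := x) r
          have h7 : L * (r - a) ≤ 1 / 2 :=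
            (mul_le_mul_of_nonneg_left (by linarith [hr.2]) hL).trans hLη
          gcongr
        linarith
    rw [pow_succ]
    linarith

theorem exists_runSup_le (T : ℝ) (d : ℕ) {L s₀ : ℝ} (hL : 0 ≤ L) (hs₀ : s₀ ∈ Ico 0 T) (m : ℝ) :
    ∃ C, ∀ x : Path d, BddAbove ((fun s => ‖x s‖) '' Icc 0 T) → IncrementBound T d L s₀ x →
      runSup d x s₀ ≤ m → runSup d x T ≤ C := by
  obtain ⟨n, hn⟩ := exists_nat_gt (2 * L * (T - s₀))
  have hT : 0 < T - s₀ := sub_pos.2 hs₀.2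
  have hn0 : (0 : ℝ) < n := lt_of_le_of_lt (by positivity) hn
  refine ⟨2 ^ n * (1 + m), fun x hb h hm => ?_⟩
  have e : s₀ + n * ((T - s₀) / n) = T := by field_simp; ring
  have := h.one_add_runSup_le hL hs₀.1 hb (η := (T - s₀) / n) (by positivity)
    (by rw [← mul_div_assoc, div_le_iff₀ hn0]; linarith) n e.le
  rw [e] at this
  have h2 : (2 : ℝ) ^ n * (1 + runSup d x s₀) ≤ 2 ^ n * (1 + m) := by gcongr
  linarith

/-- The fundamental theorem of calculus for Lipschitz paths. -/
theorem integral_deriv_eq_sub_of_lipschitzWith {d : ℕ} {z : Path d} {K : NNReal}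
    (hz : LipschitzWith K z) (a b : ℝ) : ∫ s in a..b, deriv z s = z b - z a := by
  have hint : IntervalIntegrable (deriv z) volume a b :=
    (intervalIntegrable_const (c := (K : ℝ))).mono_fun
      (measurable_deriv z).aestronglyMeasurable
      (Eventually.of_forall fun s => by simpa using norm_deriv_le_of_lipschitz hz)
  ext i
  have hcomm := (EuclideanSpace.proj i : E d →L[ℝ] ℝ).intervalIntegral_comp_comm hint
  have hzi : LipschitzWith K fun s => z s i := by
    refine LipschitzWith.of_dist_le_mul fun s t => ?_
    refine le_trans ?_ (hz.dist_le_mul s t)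
    rw [dist_eq_norm, dist_eq_norm]
    exact PiLp.norm_apply_le (z s - z t) i
  have hftc := (hzi.lipschitzOnWith
    (s := uIcc a b)).absolutelyContinuousOnInterval.integral_deriv_eq_sub
  refine hcomm.symm.trans (Eq.trans ?_ hftc)
  refine intervalIntegral.integral_congr_ae ?_
  filter_upwards [hz.ae_differentiableAt] with s hs _
  exact (((EuclideanSpace.proj i : E d →L[ℝ] ℝ).hasFDerivAt.comp_hasDerivAt s
    hs.hasDerivAt).deriv).symm

/-- The path equal to `x₀` before `s₀` and to `f` on `[s₀, T]`. -/
def glue {T : ℝ} {d : ℕ} {s₀ : ℝ} (h : s₀ ≤ T) (x₀ : Path d) (f : Icc s₀ T →ᵇ E d) : Path d :=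
  fun t => if t < s₀ then x₀ t else f (projIcc s₀ T h t)

section Glue

variable {T : ℝ} {d : ℕ} {s₀ : ℝ} (h : s₀ ≤ T) {x₀ : Path d} {f : Icc s₀ T →ᵇ E d}

theorem glue_of_lt {t : ℝ} (ht : t < s₀) : glue h x₀ f t = x₀ t := if_pos ht

theorem glue_of_le {t : ℝ} (ht : s₀ ≤ t) : glue h x₀ f t = f (projIcc s₀ T h t) :=
  if_neg ht.not_gt

theorem glue_of_mem {t : ℝ} (ht : t ∈ Icc s₀ T) : glue h x₀ f t = f ⟨t, ht⟩ := by
  rw [glue_of_le h ht.1, projIcc_of_mem h ht]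

theorem glue_eq_of_le (hf : f ⟨s₀, left_mem_Icc.2 h⟩ = x₀ s₀) {t : ℝ} (ht : t ≤ s₀) :
    glue h x₀ f t = x₀ t := by
  rcases ht.lt_or_eq with h' | rfl
  · exact glue_of_lt h h'
  · rw [glue_of_mem h (left_mem_Icc.2 h), hf]

theorem norm_glue_sub_le (f g : Icc s₀ T →ᵇ E d) (t : ℝ) :
    ‖glue h x₀ f t - glue h x₀ g t‖ ≤ dist f g := by
  rcases lt_or_ge t s₀ with ht | ht
  · rw [glue_of_lt h ht, glue_of_lt h ht, sub_self, norm_zero]; exact dist_nonneg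
  · rw [glue_of_le h ht, glue_of_le h ht, ← dist_eq_norm]
    exact BoundedContinuousFunction.dist_coe_le_dist _

theorem bddAbove_glue (hx₀ : x₀ ∈ Cadlag T d) :
    BddAbove ((fun s => ‖glue h x₀ f s‖) '' Icc 0 T) := by
  obtain ⟨C, hC⟩ := Cadlag.bddAbove hx₀
  refine ⟨max C ‖f‖, ?_⟩
  rintro _ ⟨s, hs, rfl⟩
  rcases lt_or_ge s s₀ with hs' | hs'
  · simp only [glue_of_lt h hs']
    exact le_max_of_le_left (hC ⟨s, hs, rfl⟩)
  · simp only [glue_of_le h hs']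
    exact le_max_of_le_right (f.norm_coe_le_norm _)

theorem continuous_runSup_glue (hx₀ : x₀ ∈ Cadlag T d) {t : ℝ} (ht : t ∈ Icc 0 T) :
    Continuous fun f : Icc s₀ T →ᵇ E d => runSup d (glue h x₀ f) t := by
  refine (LipschitzWith.of_le_add fun f g => ?_).continuous
  refine runSup_le ht.1 fun s hs => ?_
  have h1 := norm_glue_sub_le h (x₀ := x₀) f g s
  have h2 := norm_le_runSup (bddAbove_glue h (f := g) hx₀) hs.1 hs.2 ht.2
  have h3 : ‖glue h x₀ f s‖ ≤ ‖glue h x₀ g s‖ + ‖glue h x₀ f s - glue h x₀ g s‖ := by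
    simpa using norm_add_le (glue h x₀ g s) (glue h x₀ f s - glue h x₀ g s)
  linarith

theorem continuous_toUnif_glue : Continuous fun f => toUnif T d (glue h x₀ f) := by
  rw [continuous_iff_continuousAt]
  intro f
  rw [ContinuousAt, UniformFun.tendsto_iff_tendstoUniformly, Metric.tendstoUniformly_iff]
  intro ε hε
  filter_upwards [Metric.ball_mem_nhds f hε] with g hg t
  refine lt_of_le_of_lt ?_ (Metric.mem_ball'.1 hg)
  rw [dist_eq_norm]
  exact norm_glue_sub_le h f g t

theorem glue_mem_cadlag (hx₀ : x₀ ∈ Cadlag T d) : glue h x₀ f ∈ Cadlag T d := by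
  have hc : Continuous fun t => f (projIcc s₀ T h t) := f.continuous.comp continuous_projIcc
  refine ⟨fun t ht => ?_, fun t ht => ?_⟩
  · rcases lt_or_ge t s₀ with h' | h'
    · refine (hx₀.1 t ht).congr_of_eventuallyEq ?_ (glue_of_lt h h')
      filter_upwards [nhdsWithin_le_nhds (Iio_mem_nhds h')] with s hs using glue_of_lt h hs
    · exact hc.continuousWithinAt.congr (fun s hs => glue_of_le h (h'.trans hs))
        (glue_of_le h h')
  · rcases le_or_gt t s₀ with h' | h'
    · obtain ⟨l, hl⟩ := hx₀.2 t ht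
      refine ⟨l, hl.congr' ?_⟩
      filter_upwards [self_mem_nhdsWithin] with s hs
      exact (glue_of_lt h (lt_of_lt_of_le hs h')).symm
    · refine ⟨_, (hc.tendsto t |>.mono_left nhdsWithin_le_nhds).congr' ?_⟩
      filter_upwards [nhdsWithin_le_nhds (Ioi_mem_nhds h')] with s hs
      exact (glue_of_le h (le_of_lt hs)).symm

end Glue

/-- A path satisfying the integrated growth bound has a derivative satisfying the growth bound. -/
theorem IncrementBound.exists_xDeriv {T : ℝ} {d : ℕ} {L s₀ : ℝ} {x : Path d} (hL : 0 ≤ L)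
    (hs₀ : s₀ ∈ Ico 0 T) (hb : BddAbove ((fun s => ‖x s‖) '' Icc 0 T))
    (h : IncrementBound T d L s₀ x) : ∃ g, XDeriv T d L s₀ x g := by
  have hle : s₀ ≤ T := hs₀.2.le
  obtain ⟨K, hK⟩ : ∃ K : NNReal, (K : ℝ) = L * (1 + runSup d x T) :=
    CanLift.prf _ (mul_nonneg hL (add_nonneg zero_le_one (runSup_nonneg T)))
  have hmono : ∀ s t, s₀ ≤ s → s ≤ t → t ≤ T → ‖x t - x s‖ ≤ K * (t - s) := by
    intro s t hs hst ht
    refine (h s t hs hst ht).trans ?_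
    have h1 := runSup_mono hb (hs₀.1.trans (hs.trans hst)) ht le_rfl
    have h2 : 0 ≤ L * (t - s) := mul_nonneg hL (sub_nonneg.2 hst)
    calc L * (t - s) * (1 + runSup d x t) ≤ L * (t - s) * (1 + runSup d x T) := by gcongr
      _ = K * (t - s) := by rw [hK]; ring
  have hlip : LipschitzWith K fun u : Icc s₀ T => x u := by
    refine LipschitzWith.of_dist_le_mul fun u v => ?_
    rw [dist_eq_norm, Subtype.dist_eq, Real.dist_eq]
    rcases le_total (u : ℝ) v with huv | hvu
    · rw [norm_sub_rev, abs_sub_comm, abs_of_nonneg (sub_nonneg.2 huv)]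
      exact hmono u v u.2.1 huv v.2.2
    · rw [abs_of_nonneg (sub_nonneg.2 hvu)]
      exact hmono v u v.2.1 hvu u.2.2
  set z : Path d := fun t => x (projIcc s₀ T hle t) with hzdef
  have hz : LipschitzWith K z := by
    have := hlip.comp (LipschitzWith.projIcc hle)
    rwa [mul_one] at this
  have hzx : ∀ t ∈ Icc s₀ T, z t = x t := fun t ht => by
    simp only [hzdef, projIcc_of_mem hle ht]
  refine ⟨deriv z, ?_, fun t ht => ?_, ?_⟩
  · exact Measure.integrableOn_of_bounded (M := K) (by simp)
      (measurable_deriv z).aestronglyMeasurable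
      (Eventually.of_forall fun s => norm_deriv_le_of_lipschitz hz)
  · rw [integral_deriv_eq_sub_of_lipschitzWith hz, hzx t ht, hzx s₀ (left_mem_Icc.2 hle)]
    abel
  · rw [ae_restrict_iff' measurableSet_Ioo]
    filter_upwards [hz.ae_differentiableAt] with t hdt ht
    have hslope := (hasDerivAt_iff_tendsto_slope.1 hdt.hasDerivAt).mono_left
      (nhdsWithin_mono t (show Iio t ⊆ {t}ᶜ from fun s hs => ne_of_lt hs))
    refine le_of_tendsto hslope.norm ?_
    filter_upwards [self_mem_nhdsWithin, nhdsWithin_le_nhds (Ioi_mem_nhds ht.1)] with s hst hs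
    have hst' : 0 < t - s := sub_pos.2 hst
    have := h s t (le_of_lt hs) (le_of_lt hst) ht.2.le
    rw [slope_comm, slope_def_module, norm_smul, norm_inv, Real.norm_of_nonneg hst'.le,
      hzx t ⟨ht.1.le, ht.2.le⟩, hzx s ⟨le_of_lt hs, (le_of_lt hst).trans ht.2.le⟩,
      inv_mul_le_iff₀ hst']
    linarith

theorem toUnif_image_XSet (T : ℝ) (d : ℕ) {L s₀ : ℝ} (hL : 0 ≤ L) (hs₀ : s₀ ∈ Ico 0 T)
    {x₀ : Path d} (hx₀ : x₀ ∈ Cadlag T d) :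
    toUnif T d '' XSet T d L s₀ x₀ = (fun f => toUnif T d (glue hs₀.2.le x₀ f)) ''
      {f | f ⟨s₀, left_mem_Icc.2 hs₀.2.le⟩ = x₀ s₀ ∧
        IncrementBound T d L s₀ (glue hs₀.2.le x₀ f)} := by
  have hle : s₀ ≤ T := hs₀.2.le
  apply Subset.antisymm
  · rintro _ ⟨x, ⟨hxc, hx0, g, hg⟩, rfl⟩
    have hinc := hg.incrementBound hL hs₀.1 (Cadlag.bddAbove hxc)
    have hcont : ContinuousOn x (Icc s₀ T) := by
      have : ContinuousOn (fun t => x s₀ + ∫ s in s₀..t, g s) (Icc s₀ T) :=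
        continuousOn_const.add (intervalIntegral.continuousOn_primitive_interval
          (by rw [uIcc_of_le hle]; exact hg.1) |>.mono (by rw [uIcc_of_le hle]))
      exact this.congr hg.2.1
    let f : Icc s₀ T →ᵇ E d := BoundedContinuousFunction.mkOfCompact
      ⟨fun u => x u, hcont.domRestrict⟩
    have hglue : EqOn (glue hle x₀ f) x (Icc 0 T) := by
      intro t ht
      rcases lt_or_ge t s₀ with h' | h'
      · rw [glue_of_lt hle h', hx0 t ⟨ht.1, h'.le⟩]
      · rw [glue_of_mem hle ⟨h', ht.2⟩]; rfl
    refine ⟨f, ⟨hx0 s₀ ⟨hs₀.1, le_rfl⟩, fun s t hs hst ht => ?_⟩, ?_⟩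
    · rw [hglue ⟨hs₀.1.trans (hs.trans hst), ht⟩, hglue ⟨hs₀.1.trans hs, hst.trans ht⟩,
        runSup_congr (hglue.mono (Icc_subset_Icc_right ht))]
      exact hinc s t hs hst ht
    · exact congrArg UniformFun.ofFun (funext fun t => hglue t.2)
  · rintro _ ⟨f, ⟨hf0, hinc⟩, rfl⟩
    exact ⟨_, ⟨glue_mem_cadlag hle hx₀, fun t ht => glue_eq_of_le hle hf0 ht.2,
      hinc.exists_xDeriv hL hs₀ (bddAbove_glue hle hx₀)⟩, rfl⟩

/-- For every `L ≥ 0` and `(s₀, x₀) ∈ [0,T) × Ω`, the set `X^L(s₀,x₀)`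
is compact in `Ω` with respect to the supremum norm (i.e. its image in the space of
functions on `[0,T]` with the topology of uniform convergence is compact). -/
theorem XSet_isCompact (T : ℝ) (hT : 0 < T) (d : ℕ) (hd : 1 ≤ d)
    (L : ℝ) (hL : 0 ≤ L) (s₀ : ℝ) (hs₀ : s₀ ∈ Ico (0 : ℝ) T)
    (x₀ : Path d) (hx₀ : x₀ ∈ Cadlag T d) :
    IsCompact (toUnif T d '' XSet T d L s₀ x₀) := by
  have hle : s₀ ≤ T := hs₀.2.le
  rw [toUnif_image_XSet T d hL hs₀ hx₀]
  refine IsCompact.image ?_ (continuous_toUnif_glue hle)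
  have hcg : ∀ t, Continuous fun f : Icc s₀ T →ᵇ E d => glue hle x₀ f t := fun t =>
    (LipschitzWith.of_dist_le_mul (K := 1) fun f g => by
      simpa [dist_eq_norm] using norm_glue_sub_le hle (x₀ := x₀) f g t).continuous
  obtain ⟨C, hC⟩ := exists_runSup_le T d hL hs₀ (runSup d x₀ s₀)
  have hCb : ∀ f : Icc s₀ T →ᵇ E d, f ⟨s₀, left_mem_Icc.2 hle⟩ = x₀ s₀ →
      IncrementBound T d L s₀ (glue hle x₀ f) → runSup d (glue hle x₀ f) T ≤ C :=
    fun f hf0 hinc => hC _ (bddAbove_glue hle hx₀) hinc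
      (runSup_congr fun t ht => glue_eq_of_le hle hf0 ht.2).le
  refine BoundedContinuousFunction.arzela_ascoli₂ (Metric.closedBall 0 C)
    (isCompact_closedBall 0 C) _ ?_ ?_ ?_
  · have hcl : IsClosed {f | IncrementBound T d L s₀ (glue hle x₀ f)} := by
      simp only [IncrementBound, ofPred_forall]
      refine isClosed_iInter fun s => isClosed_iInter fun t => isClosed_iInter fun hs =>
        isClosed_iInter fun hst => isClosed_iInter fun ht => ?_
      exact isClosed_le ((hcg t).sub (hcg s)).norm (continuous_const.mul (continuous_const.add
        (continuous_runSup_glue hle hx₀ ⟨hs₀.1.trans (hs.trans hst), ht⟩)))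
    exact (isClosed_eq (by fun_prop) continuous_const).inter hcl
  · rintro f t ⟨hf0, hinc⟩
    rw [mem_closedBall_zero_iff, ← glue_of_mem hle (x₀ := x₀) t.2]
    exact (norm_le_runSup (bddAbove_glue hle hx₀) (hs₀.1.trans t.2.1) t.2.2 le_rfl).trans
      (hCb f hf0 hinc)
  · refine Metric.equicontinuous_of_continuity_modulus (fun r => L * r * (1 + C))
      (Continuous.tendsto' (by fun_prop) _ _ (by simp)) _ ?_
    have key : ∀ (s t : Icc s₀ T) (f : Icc s₀ T →ᵇ E d),
        f ⟨s₀, left_mem_Icc.2 hle⟩ = x₀ s₀ → IncrementBound T d L s₀ (glue hle x₀ f) →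
        s ≤ t → dist (f s) (f t) ≤ L * dist s t * (1 + C) := by
      intro s t f hf0 hinc hst
      have hst' : (s : ℝ) ≤ t := hst
      have h1 := hinc s t s.2.1 hst t.2.2
      rw [glue_of_mem hle s.2, glue_of_mem hle t.2] at h1
      have h2 := runSup_mono (bddAbove_glue hle (f := f) hx₀) (hs₀.1.trans t.2.1) t.2.2 le_rfl
      have h3 := hCb f hf0 hinc
      rw [dist_comm, dist_eq_norm, Subtype.dist_eq, Real.dist_eq, abs_sub_comm,
        abs_of_nonneg (sub_nonneg.2 hst')]
      refine h1.trans ?_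
      have h4 : 0 ≤ L * ((t : ℝ) - s) := mul_nonneg hL (sub_nonneg.2 hst')
      gcongr
      exact h2.trans h3
    rintro s t ⟨f, hf0, hinc⟩
    rcases le_total s t with hst | hts
    · exact key s t f hf0 hinc hst
    · rw [dist_comm, dist_comm s t]
      exact key t s f hf0 hinc hts

end PHJ
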